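/- Let w be a word, α > 1 and 6/7 ≤ β < 1 real numbers. Map each maximal α-gapped β-aperiodic palindrome (L,R) of w to the point (m,d) with m = ⌈(beg(L)+end(L))/2⌉ and d = ⌊(beg(R)+end(R))/2⌋ - m. Then the points obtained from two distinct maximal α-gapped β-aperiodic palindromes cannot ((1-β)/α)-cover the same point of ℤ². -/

import Mathlib

/-- `(L,R) = ([lb..le],[rb..re])` is a gapped palindrome of the word `w` of length `n`:
the factor at `R` is the reverse of the factor at `L`. -/
def IsGP {A : Type*} (w : ℕ → A) (n lb le rb re : ℕ) : Prop :=
  1 ≤ lb ∧ lb ≤ le ∧ lb ≤ rb ∧ rb ≤ re ∧ re ≤ n ∧ re - rb = le - lb ∧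
    ∀ k, k ≤ le - lb → w (lb + k) = w (re - k)

/-- Maximal gapped palindrome: extendable neither outwards nor inwards. -/
def IsMaxGP {A : Type*} (w : ℕ → A) (n lb le rb re : ℕ) : Prop :=
  IsGP w n lb le rb re ∧ (lb = 1 ∨ re = n ∨ w (lb - 1) ≠ w (re + 1)) ∧
    w (le + 1) ≠ w (rb - 1)

/-- α-gapped: the period `rb - lb` is at most `α` times the arm length. -/
def AlphaGapped (α : ℝ) (lb le rb : ℕ) : Prop :=
  ((rb : ℝ) - lb) ≤ α * ((le : ℝ) - lb + 1)

/-- `p` is a period of the segment `[a..b]` of `w`. -/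
def SegPeriod {A : Type*} (w : ℕ → A) (a b p : ℕ) : Prop :=
  ∀ i, a ≤ i → i + p ≤ b → w i = w (i + p)

/-- `[a..b]` is a run of `w` (of length `n`) with smallest period `p`:
a maximal periodic segment. -/
def IsRun {A : Type*} (w : ℕ → A) (n a b p : ℕ) : Prop :=
  1 ≤ a ∧ a ≤ b ∧ b ≤ n ∧ 0 < p ∧ 2 * p ≤ b - a + 1 ∧ SegPeriod w a b p ∧
    (∀ q, 0 < q → SegPeriod w a b q → p ≤ q) ∧
    (a = 1 ∨ ¬ SegPeriod w (a - 1) b p) ∧ (b = n ∨ ¬ SegPeriod w a (b + 1) p)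

/-- Sum of exponents of all runs of `w`. -/
noncomputable def SumExp {A : Type*} (w : ℕ → A) (n : ℕ) : ℝ :=
  ∑ᶠ r ∈ {r : ℕ × ℕ × ℕ | IsRun w n r.1 r.2.1 r.2.2},
    (((r.2.1 : ℝ) - (r.1 : ℝ) + 1) / (r.2.2 : ℝ))

/-- The segment `[lb..le]` has a periodic suffix of length at least `β(le - lb + 1)`
(a segment is periodic if its smallest period is at most half its length). -/
def HasPerSuffix {A : Type*} (w : ℕ → A) (lb le : ℕ) (β : ℝ) : Prop :=
  ∃ ℓ p : ℕ, 0 < p ∧ 2 * p ≤ ℓ ∧ ℓ ≤ le - lb + 1 ∧ β * ((le : ℝ) - (lb : ℝ) + 1) ≤ (ℓ : ℝ) ∧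
    ∀ i, le + 1 - ℓ ≤ i → i + p ≤ le → w i = w (i + p)

/-- β-periodic gapped palindrome: `L ≢ R` and the left arm has a periodic suffix
of length at least `β|L|`. -/
def BetaPeriodicGP {A : Type*} (w : ℕ → A) (lb le rb : ℕ) (β : ℝ) : Prop :=
  lb ≠ rb ∧ HasPerSuffix w lb le β

/-- Ordinary palindrome: `L ≡ R`. -/
def OrdinaryGP (lb rb : ℕ) : Prop := lb = rb

/-- β-aperiodic maximal α-gapped palindrome: a maximal α-gapped palindrome that
is neither β-periodic nor an ordinary palindrome. -/
def BetaAperiodicMaxGP {A : Type*} (w : ℕ → A) (n : ℕ) (α β : ℝ)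
    (lb le rb re : ℕ) : Prop :=
  IsMaxGP w n lb le rb re ∧ AlphaGapped α lb le rb ∧
    ¬ BetaPeriodicGP w lb le rb β ∧ ¬ OrdinaryGP lb rb

/-- `m = ⌈(beg L + end L)/2⌉`, the mid-position of the left arm. -/
def phiM (lb le : ℕ) : ℤ := ((lb : ℤ) + le + 1) / 2

/-- `d = ⌊(beg R + end R)/2⌋ - m`. -/
def phiD (lb le rb re : ℕ) : ℤ := ((rb : ℤ) + re) / 2 - phiM lb le

/-- `(x̂,ŷ)` γ-covers `(x,y)` iff `x̂ - γŷ ≤ x ≤ x̂` and `ŷ(1-γ) ≤ y ≤ ŷ`. -/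
def Covers (γ : ℝ) (c q : ℤ × ℤ) : Prop :=
  (c.1 : ℝ) - γ * c.2 ≤ q.1 ∧ q.1 ≤ c.1 ∧ (c.2 : ℝ) * (1 - γ) ≤ (q.2 : ℝ) ∧ q.2 ≤ c.2

/-- The reflection property of a gapped palindrome. -/
lemma gp_sym {A : Type*} {w : ℕ → A} {n lb le rb : ℕ}
    (h : IsGP w n lb le rb (rb + (le - lb))) (i j : ℕ) (hi : lb ≤ i) (hi' : i ≤ le)
    (hj : i + j = le + rb) : w i = w j := by
  obtain ⟨h1, h2, h3, h4, h5, h6, h7⟩ := h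
  have := h7 (i - lb) (by omega)
  rw [show lb + (i - lb) = i by omega, show rb + (le - lb) - (i - lb) = j by omega] at this
  exact this

lemma per_of_start {A : Type*} {w : ℕ → A} {lb le : ℕ} {β : ℝ} (a p : ℕ)
    (ha : lb ≤ a) (hp : 0 < p) (h2 : 2 * p + a ≤ le + 1)
    (hβ : β * ((le : ℝ) - lb + 1) ≤ (le : ℝ) + 1 - a)
    (hw : ∀ i, a ≤ i → i + p ≤ le → w i = w (i + p)) : HasPerSuffix w lb le β := by
  refine ⟨le + 1 - a, p, hp, by omega, by omega, ?_, fun i hi hi' => hw i (by omega) hi'⟩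
  rw [Nat.cast_sub (by omega)]
  push_cast
  exact hβ

/-- Two maximal gapped palindromes with the same centre and touching arms agree. -/
lemma same_center {A : Type*} {w : ℕ → A} {n lb₁ le₁ rb₁ lb₂ le₂ rb₂ : ℕ}
    (h₁ : IsMaxGP w n lb₁ le₁ rb₁ (rb₁ + (le₁ - lb₁)))
    (h₂ : IsMaxGP w n lb₂ le₂ rb₂ (rb₂ + (le₂ - lb₂)))
    (hr₁ : lb₁ < rb₁) (hr₂ : lb₂ < rb₂)
    (hc : le₁ + rb₁ = le₂ + rb₂) (ho₁ : lb₂ ≤ le₁) (ho₂ : lb₁ ≤ le₂) :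
    lb₁ = lb₂ ∧ le₁ = le₂ ∧ rb₁ = rb₂ := by
  obtain ⟨g₁, o₁, i₁⟩ := h₁
  obtain ⟨g₂, o₂, i₂⟩ := h₂
  have s₁ := gp_sym g₁
  have s₂ := gp_sym g₂
  obtain ⟨a1, a2, a3, a4, a5, a6, a7⟩ := g₁
  obtain ⟨b1, b2, b3, b4, b5, b6, b7⟩ := g₂
  have hle : le₁ = le₂ := by
    rcases lt_trichotomy le₁ le₂ with h | h | h
    · exact absurd (s₂ (le₁ + 1) (rb₁ - 1) (by omega) (by omega) (by omega)) i₁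
    · exact h
    · exact absurd (s₁ (le₂ + 1) (rb₂ - 1) (by omega) (by omega) (by omega)) i₂
  have hlb : lb₁ = lb₂ := by
    rcases lt_trichotomy lb₁ lb₂ with h | h | h
    · rcases o₂ with o | o | o
      · omega
      · omega
      · exact absurd (s₁ (lb₂ - 1) _ (by omega) (by omega) (by omega)) o
    · exact h
    · rcases o₁ with o | o | o
      · omega
      · omega
      · exact absurd (s₂ (lb₁ - 1) _ (by omega) (by omega) (by omega)) o
  omega

set_option maxHeartbeats 1000000 in
lemma cover_aux {A : Type*} (w : ℕ → A) (n : ℕ)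
    (α β : ℝ) (hα : 1 < α) (hβ0 : 6/7 ≤ β) (hβ1 : β < 1)
    (lb₁ le₁ rb₁ lb₂ le₂ rb₂ : ℕ)
    (h₁ : BetaAperiodicMaxGP w n α β lb₁ le₁ rb₁ (rb₁ + (le₁ - lb₁)))
    (h₂ : BetaAperiodicMaxGP w n α β lb₂ le₂ rb₂ (rb₂ + (le₂ - lb₂)))
    (hne : (lb₁, le₁, rb₁) ≠ (lb₂, le₂, rb₂)) (q : ℤ × ℤ)
    (c₁ : Covers ((1 - β) / α)
          (phiM lb₁ le₁, phiD lb₁ le₁ rb₁ (rb₁ + (le₁ - lb₁))) q)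
    (c₂ : Covers ((1 - β) / α)
          (phiM lb₂ le₂, phiD lb₂ le₂ rb₂ (rb₂ + (le₂ - lb₂))) q)
    (ho : le₁ + rb₁ < le₂ + rb₂ ∨
      (le₁ + rb₁ = le₂ + rb₂ ∧ phiM lb₁ le₁ ≤ phiM lb₂ le₂)) : False := by
  obtain ⟨x, y⟩ := q
  obtain ⟨m₁, ag₁, np₁, no₁⟩ := h₁
  obtain ⟨m₂, ag₂, np₂, no₂⟩ := h₂
  have np₁ : ¬ HasPerSuffix w lb₁ le₁ β := fun h => np₁ ⟨no₁, h⟩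
  have np₂ : ¬ HasPerSuffix w lb₂ le₂ β := fun h => np₂ ⟨no₂, h⟩
  have s₁ := gp_sym m₁.1
  have s₂ := gp_sym m₂.1
  obtain ⟨a1, a2, a3, -, a5, -, -⟩ := m₁.1
  obtain ⟨b1, b2, b3, -, b5, -, -⟩ := m₂.1
  have r₁ : lb₁ < rb₁ := lt_of_le_of_ne a3 no₁
  have r₂ : lb₂ < rb₂ := lt_of_le_of_ne b3 no₂
  unfold AlphaGapped at ag₁ ag₂
  unfold Covers at c₁ c₂
  obtain ⟨c11, c12, c13, c14⟩ := c₁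
  obtain ⟨c21, c22, c23, c24⟩ := c₂
  dsimp only at c11 c12 c13 c14 c21 c22 c23 c24
  -- integer facts about the midpoints
  obtain ⟨p₁, hp₁, hp₁', hM₁, hD₁⟩ : ∃ p : ℤ, 0 ≤ p ∧ p ≤ 1 ∧
      2 * phiM lb₁ le₁ = lb₁ + le₁ + p ∧
      phiD lb₁ le₁ rb₁ (rb₁ + (le₁ - lb₁)) = rb₁ - lb₁ - p := by
    refine ⟨((lb₁ : ℤ) + le₁) % 2, ?_⟩
    unfold phiD phiM
    omega
  obtain ⟨p₂, hp₂, hp₂', hM₂, hD₂⟩ : ∃ p : ℤ, 0 ≤ p ∧ p ≤ 1 ∧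
      2 * phiM lb₂ le₂ = lb₂ + le₂ + p ∧
      phiD lb₂ le₂ rb₂ (rb₂ + (le₂ - lb₂)) = rb₂ - lb₂ - p := by
    refine ⟨((lb₂ : ℤ) + le₂) % 2, ?_⟩
    unfold phiD phiM
    omega
  generalize phiD lb₁ le₁ rb₁ (rb₁ + (le₁ - lb₁)) = D₁ at *
  generalize phiD lb₂ le₂ rb₂ (rb₂ + (le₂ - lb₂)) = D₂ at *
  generalize phiM lb₁ le₁ = M₁ at *
  generalize phiM lb₂ le₂ = M₂ at *
  -- real facts
  obtain ⟨g, hg⟩ : ∃ g, g = (1 - β) / α := ⟨_, rfl⟩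
  rw [← hg] at c11 c13 c21 c23
  have hgα : g * α = 1 - β := by rw [hg]; field_simp
  have hg0 : 0 < g := by rw [hg]; exact div_pos (by linarith) (by linarith)
  have hg1 : g ≤ 1 / 7 := by nlinarith
  have e₁ : g * D₁ ≤ (1 - β) * ((le₁ : ℝ) - lb₁ + 1) := by
    have : (D₁ : ℝ) ≤ rb₁ - lb₁ := by exact_mod_cast (by omega : D₁ ≤ (rb₁ : ℤ) - lb₁)
    rw [← hgα, mul_assoc]
    exact mul_le_mul_of_nonneg_left (this.trans ag₁) hg0.le
  have e₂ : g * D₂ ≤ (1 - β) * ((le₂ : ℝ) - lb₂ + 1) := by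
    have : (D₂ : ℝ) ≤ rb₂ - lb₂ := by exact_mod_cast (by omega : D₂ ≤ (rb₂ : ℤ) - lb₂)
    rw [← hgα, mul_assoc]
    exact mul_le_mul_of_nonneg_left (this.trans ag₂) hg0.le
  have l₁ : (0 : ℝ) ≤ (le₁ : ℝ) - lb₁ := by
    have : (lb₁ : ℝ) ≤ le₁ := by exact_mod_cast a2
    linarith
  have l₂ : (0 : ℝ) ≤ (le₂ : ℝ) - lb₂ := by
    have : (lb₂ : ℝ) ≤ le₂ := by exact_mod_cast b2
    linarith
  have f₁ : (1 - β) * ((le₁ : ℝ) - lb₁ + 1) ≤ 1 / 7 * ((le₁ : ℝ) - lb₁ + 1) :=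
    mul_le_mul_of_nonneg_right (by linarith) (by linarith)
  have f₂ : (1 - β) * ((le₂ : ℝ) - lb₂ + 1) ≤ 1 / 7 * ((le₂ : ℝ) - lb₂ + 1) :=
    mul_le_mul_of_nonneg_right (by linarith) (by linarith)
  have x₁ : (x : ℝ) ≤ M₁ := by exact_mod_cast c12
  have x₂ : (x : ℝ) ≤ M₂ := by exact_mod_cast c22
  have y₁ : (y : ℝ) ≤ D₁ := by exact_mod_cast c14
  have y₂ : (y : ℝ) ≤ D₂ := by exact_mod_cast c24
  have z₁ : (D₁ : ℝ) - y ≤ g * D₁ := by linarith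
  have z₂ : (D₂ : ℝ) - y ≤ g * D₂ := by linarith
  have n₁ : 0 ≤ (1 - β) * ((le₁ : ℝ) - lb₁ + 1) := mul_nonneg (by linarith) (by linarith)
  have n₂ : 0 ≤ (1 - β) * ((le₂ : ℝ) - lb₂ + 1) := mul_nonneg (by linarith) (by linarith)
  rcases ho with hc | ⟨hc, hm⟩
  · obtain ⟨δ, hδ⟩ : ∃ δ : ℕ, le₂ + rb₂ = le₁ + rb₁ + δ := ⟨_, (Nat.add_sub_of_le hc.le).symm⟩
    have hδ0 : 0 < δ := by omega
    have hδZ : (δ : ℤ) = 2 * (M₂ - M₁) + (D₂ - D₁) := by omega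
    have hδR : (δ : ℝ) = 2 * ((M₂ : ℝ) - M₁) + ((D₂ : ℝ) - D₁) := by exact_mod_cast hδZ
    have hδ3 : (δ : ℝ) ≤ 3 * (g * D₂) := by linarith
    have per : ∀ i, lb₁ ≤ i → i ≤ le₁ → lb₂ ≤ i + δ → i + δ ≤ le₂ → w i = w (i + δ) := by
      intro i h1 h2 h3 h4
      rw [s₁ i (le₁ + rb₁ - i) h1 h2 (by omega),
        s₂ (i + δ) (le₁ + rb₁ - i) h3 h4 (by omega)]
    have hD2nn : (0 : ℝ) ≤ D₂ := by exact_mod_cast (by omega : (0 : ℤ) ≤ D₂)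
    have k₁ : 2 * δ ≤ le₁ - lb₁ + 1 := by
      have h6 : 6 / 7 * (g * D₂) ≤ g * D₁ := by
        have h61 : (D₂ : ℝ) * (6 / 7) ≤ D₂ * (1 - g) :=
          mul_le_mul_of_nonneg_left (by linarith) hD2nn
        have h62 : g * ((D₂ : ℝ) * (6 / 7)) ≤ g * D₁ :=
          mul_le_mul_of_nonneg_left (by linarith) hg0.le
        linarith
      have : (2 * (δ : ℝ)) ≤ (le₁ : ℝ) - lb₁ + 1 := by linarith
      have : 2 * (δ : ℤ) ≤ (le₁ : ℤ) - lb₁ + 1 := by exact_mod_cast this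
      omega
    -- the first palindrome is periodic if its left arm starts late
    have opt1 : le₁ ≤ le₂ → lb₂ ≤ lb₁ + δ → False := by
      intro h1 h2
      refine np₁ (per_of_start lb₁ δ le_rfl hδ0 (by omega) (by linarith) ?_)
      intro i hi hi'
      exact per i hi (by omega) (by omega) (by omega)
    by_cases hcase : le₂ ≤ le₁ + δ
    · by_cases hb : (lb₁ : ℝ) - lb₂ ≤ (1 - β) * ((le₂ : ℝ) - lb₂ + 1)
      · have hmax : ((max lb₁ lb₂ : ℕ) : ℝ) - lb₂ ≤ (1 - β) * ((le₂ : ℝ) - lb₂ + 1) := by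
          rcases max_choice lb₁ lb₂ with h | h
          · rw [h]; exact hb
          · rw [h]; linarith
        refine np₂ (per_of_start (max lb₁ lb₂) δ (le_max_right _ _) hδ0 ?_ (by linarith) ?_)
        · have : (2 * (δ : ℝ)) + (max lb₁ lb₂ : ℕ) ≤ le₂ + 1 := by linarith
          exact_mod_cast this
        · intro i hi hi'
          have := le_max_left lb₁ lb₂
          have := le_max_right lb₁ lb₂
          exact per i (by omega) (by omega) (by omega) (by omega)
      · have hk : ((D₂ - D₁ : ℤ) : ℝ) < ((lb₁ - lb₂ : ℤ) : ℝ) := by push_cast; linarith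
        have hk' : D₂ - D₁ < (lb₁ : ℤ) - lb₂ := by exact_mod_cast hk
        have hk2 : (lb₂ : ℝ) < lb₁ := by linarith
        have hk3 : lb₂ < lb₁ := by exact_mod_cast hk2
        exact opt1 (by omega) (by omega)
    · by_cases hd : D₁ ≤ D₂
      · exact opt1 (by omega) (by omega)
      · have hd' : (D₂ : ℝ) ≤ D₁ := by exact_mod_cast (by omega : D₂ ≤ D₁)
        have hloss : ((lb₂ : ℤ) - δ - lb₁) ≤ D₁ - D₂ := by omega
        have hlossR : ((lb₂ : ℝ) - δ - lb₁) ≤ D₁ - D₂ := by exact_mod_cast hloss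
        have hb : ((lb₂ : ℝ) - δ - lb₁) ≤ (1 - β) * ((le₁ : ℝ) - lb₁ + 1) := by linarith
        by_cases h0 : lb₂ ≤ lb₁ + δ
        · exact opt1 (by omega) h0
        · have hcast : ((lb₂ - δ : ℕ) : ℝ) = (lb₂ : ℝ) - δ := Nat.cast_sub (by omega)
          have hgd : g * (D₂ : ℝ) ≤ g * D₁ := mul_le_mul_of_nonneg_left hd' hg0.le
          have hδ2 : (δ : ℝ) ≤ 2 * (g * D₁) := by linarith
          refine np₁ (per_of_start (lb₂ - δ) δ (by omega) hδ0 ?_ (by rw [hcast]; linarith) ?_)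
          · have : (2 * (δ : ℝ)) + (lb₂ - δ : ℕ) ≤ le₁ + 1 := by rw [hcast]; linarith
            exact_mod_cast this
          · intro i hi hi'
            exact per i (by omega) (by omega) (by omega) (by omega)
  · have h7 : 7 * ((M₂ : ℝ) - M₁) ≤ (le₂ : ℝ) - lb₂ + 1 := by linarith
    have h7' : 7 * (M₂ - M₁) ≤ (le₂ : ℤ) - lb₂ + 1 := by exact_mod_cast h7
    have := same_center m₁ m₂ r₁ r₂ hc (by omega) (by omega)
    obtain ⟨rfl, rfl, rfl⟩ := this
    exact hne rfl

/-- For `α > 1` and `6/7 ≤ β < 1`, the midpoint-map images of two distinct maximal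
α-gapped β-aperiodic palindromes cannot `((1-β)/α)`-cover the same integer point. -/
theorem aperiodic_palindromes_no_common_cover {A : Type*} (w : ℕ → A) (n : ℕ)
    (α β : ℝ) (hα : 1 < α) (hβ0 : 6/7 ≤ β) (hβ1 : β < 1)
    (lb₁ le₁ rb₁ lb₂ le₂ rb₂ : ℕ)
    (h₁ : BetaAperiodicMaxGP w n α β lb₁ le₁ rb₁ (rb₁ + (le₁ - lb₁)))
    (h₂ : BetaAperiodicMaxGP w n α β lb₂ le₂ rb₂ (rb₂ + (le₂ - lb₂)))
    (hne : (lb₁, le₁, rb₁) ≠ (lb₂, le₂, rb₂)) :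
    ¬ ∃ q : ℤ × ℤ,
        Covers ((1 - β) / α)
          (phiM lb₁ le₁, phiD lb₁ le₁ rb₁ (rb₁ + (le₁ - lb₁))) q ∧
        Covers ((1 - β) / α)
          (phiM lb₂ le₂, phiD lb₂ le₂ rb₂ (rb₂ + (le₂ - lb₂))) q := by
  rintro ⟨q, c₁, c₂⟩
  rcases lt_trichotomy (le₁ + rb₁) (le₂ + rb₂) with h | h | h
  · exact cover_aux w n α β hα hβ0 hβ1 _ _ _ _ _ _ h₁ h₂ hne q c₁ c₂ (Or.inl h)
  · rcases le_total (phiM lb₁ le₁) (phiM lb₂ le₂) with h' | h'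
    · exact cover_aux w n α β hα hβ0 hβ1 _ _ _ _ _ _ h₁ h₂ hne q c₁ c₂ (Or.inr ⟨h, h'⟩)
    · exact cover_aux w n α β hα hβ0 hβ1 _ _ _ _ _ _ h₂ h₁ hne.symm q c₂ c₁
        (Or.inr ⟨h.symm, h'⟩)
  · exact cover_aux w n α β hα hβ0 hβ1 _ _ _ _ _ _ h₂ h₁ hne.symm q c₂ c₁ (Or.inl h)
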